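/- Let (X,𝒜,λ) be a measure space with λ a finite measure, let β > 0, and let E : X → P(ℕ) be measurable with d̄(E(x)) > β for every x in a measurable set A with λ(A) > 0. Then there exist an infinite set 𝔫 ⊆ ℕ, measurable sets A_n ⊆ A for n ∈ 𝔫, and finite sets F_n ⊆ {1,…,n} for n ∈ 𝔫 with ∂F_n ⊆ E(x) for every x ∈ A_n, such that: (i) liminf_{𝔫∋n} d_n(F_n) ≥ β; (ii) λ(A_n) ≥ e^{−nδ_n}/n² for all n ∈ 𝔫, for some reals δ_n → 0 along 𝔫; (iii) limsup_{𝔫∋n} d_n(∂F_n) = 0; (iv) lim_{M→∞} limsup_{𝔫∋n} sup_{x∈A_n} d_n(F_n∖E_M(x)) = 0; (v) liminf_{𝔫∋n} inf_{x∈A_n} d_n(E(x)∩F_n) ≥ β. -/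

import Mathlib

open Filter MeasureTheory

/-- `dens E n = #(E ∩ {1,…,n}) / n`, the frequency of `E` in `⟦1,n⟧`. -/
noncomputable def dens (E : Set ℕ) (n : ℕ) : ℝ := ((E ∩ Set.Icc 1 n).ncard : ℝ) / n

/-- Upper asymptotic density of a set of natural numbers. -/
noncomputable def upperDensity (E : Set ℕ) : ℝ := limsup (fun n => dens E n) atTop

/-- Boundary of a set of integers: elements `n ∈ E` with `n-1 ∉ E` or `n+1 ∉ E`. -/
def natBd (E : Set ℕ) : Set ℕ := {n | n ∈ E ∧ ((n - 1) ∉ E ∨ (n + 1) ∉ E)}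

/-- `thick E M` = `E_M`: union of all integer intervals `⟦a,b⟧` with `a,b ∈ E`, `b - a ≤ M`. -/
def thick (E : Set ℕ) (M : ℕ) : Set ℕ :=
  {k | ∃ a b, a ∈ E ∧ b ∈ E ∧ b ≤ a + M ∧ a ≤ k ∧ k ≤ b}

open scoped Classical in
/-- The finite set `S ∩ ⟦1,n⟧`. -/
noncomputable def cut (S : Set ℕ) (n : ℕ) : Finset ℕ := {k ∈ Finset.Icc 1 n | k ∈ S}

lemma mem_cut {S : Set ℕ} {n k : ℕ} : k ∈ cut S n ↔ (1 ≤ k ∧ k ≤ n) ∧ k ∈ S := by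
  simp [cut]

lemma cut_subset_Icc (S : Set ℕ) (n : ℕ) : cut S n ⊆ Finset.Icc 1 n :=
  fun _ hk => Finset.mem_Icc.2 (mem_cut.1 hk).1

lemma coe_cut (S : Set ℕ) (n : ℕ) : (cut S n : Set ℕ) = S ∩ Set.Icc 1 n := by
  ext k
  simp [mem_cut, and_comm]

lemma card_le_of_subset_Icc {s : Finset ℕ} {n : ℕ} (h : s ⊆ Finset.Icc 1 n) : s.card ≤ n := by
  simpa using Finset.card_le_card h

/-- The thickening `E_M` of a finite set, restricted to `⟦1,n⟧`. -/
noncomputable def hull (s : Finset ℕ) (n M : ℕ) : Finset ℕ := cut (thick (s : Set ℕ) M) n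

lemma coe_hull {s : Finset ℕ} {n : ℕ} (hs : s ⊆ Finset.Icc 1 n) (M : ℕ) :
    (hull s n M : Set ℕ) = thick (s : Set ℕ) M := by
  rw [hull, coe_cut, Set.inter_eq_left]
  rintro k ⟨a, b, ha, hb, -, hak, hkb⟩
  have h1 := Finset.mem_Icc.1 (hs ha)
  have h2 := Finset.mem_Icc.1 (hs hb)
  exact ⟨by omega, by omega⟩

lemma hull_subset_Icc (s : Finset ℕ) (n M : ℕ) : hull s n M ⊆ Finset.Icc 1 n :=
  cut_subset_Icc _ _

lemma subset_thick (S : Set ℕ) (M : ℕ) : S ⊆ thick S M :=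
  fun k hk => ⟨k, k, hk, hk, by omega, le_rfl, le_rfl⟩

lemma thick_mono {S S' : Set ℕ} {M M' : ℕ} (hS : S ⊆ S') (hM : M ≤ M') :
    thick S M ⊆ thick S' M' := by
  rintro k ⟨a, b, ha, hb, hab, h⟩
  exact ⟨a, b, hS ha, hS hb, by omega, h⟩

lemma subset_hull {s : Finset ℕ} {n : ℕ} (hs : s ⊆ Finset.Icc 1 n) (M : ℕ) :
    s ⊆ hull s n M := by
  rw [← Finset.coe_subset, coe_hull hs]
  exact subset_thick _ _

lemma hull_mono (s : Finset ℕ) (n : ℕ) {M M' : ℕ} (hM : M ≤ M') :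
    hull s n M ⊆ hull s n M' := by
  intro k hk
  rw [hull, mem_cut] at hk ⊢
  exact ⟨hk.1, thick_mono subset_rfl hM hk.2⟩

lemma natBd_thick_subset (S : Set ℕ) (M : ℕ) : natBd (thick S M) ⊆ S := by
  rintro k ⟨⟨a, b, ha, hb, hab, hak, hkb⟩, h⟩
  by_contra hk
  have h1 : a ≠ k := by rintro rfl; exact hk ha
  have h2 : b ≠ k := by rintro rfl; exact hk hb
  rcases h with h | h
  · exact h ⟨a, b, ha, hb, hab, by omega, by omega⟩
  · exact h ⟨a, b, ha, hb, hab, by omega, by omega⟩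

/-- Left endpoints of the connected components of a set of integers. -/
def leftBd (T : Set ℕ) : Set ℕ := {k | k ∈ T ∧ (k - 1) ∉ T}

/-- Right endpoints of the connected components of a set of integers. -/
def rightBd (T : Set ℕ) : Set ℕ := {k | k ∈ T ∧ (k + 1) ∉ T}

lemma natBd_eq_union (T : Set ℕ) : natBd T = leftBd T ∪ rightBd T := by
  ext k
  simp only [natBd, leftBd, rightBd, Set.mem_ofPred_eq, Set.mem_union]
  tauto

/-- Any two distinct elements are at distance more than `M`. -/
def Separated (S : Set ℕ) (M : ℕ) : Prop := ∀ k ∈ S, ∀ l ∈ S, k < l → k + M < l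

lemma separated_leftBd_thick (S : Set ℕ) (M : ℕ) : Separated (leftBd (thick S M)) M := by
  intro k hk l hl hkl
  have h1 := natBd_thick_subset S M (by rw [natBd_eq_union]; exact Or.inl hk)
  have h2 := natBd_thick_subset S M (by rw [natBd_eq_union]; exact Or.inl hl)
  by_contra hlt
  exact hl.2 ⟨k, l, h1, h2, by omega, by omega, by omega⟩

lemma separated_rightBd_thick (S : Set ℕ) (M : ℕ) : Separated (rightBd (thick S M)) M := by
  intro k hk l hl hkl
  have h1 := natBd_thick_subset S M (by rw [natBd_eq_union]; exact Or.inr hk)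
  have h2 := natBd_thick_subset S M (by rw [natBd_eq_union]; exact Or.inr hl)
  by_contra hlt
  exact hk.2 ⟨k, l, h1, h2, by omega, by omega, by omega⟩

lemma eq_of_endpoints_eq {T T' : Set ℕ} (h0 : 0 ∉ T) (h0' : 0 ∉ T')
    (hl : leftBd T = leftBd T') (hr : rightBd T = rightBd T') : T = T' := by
  ext k
  induction k with
  | zero => simp [h0, h0']
  | succ k ih =>
    have h1 := Set.ext_iff.1 hl (k + 1)
    have h2 := Set.ext_iff.1 hr k
    simp only [leftBd, rightBd, Set.mem_ofPred_eq, Nat.add_sub_cancel] at h1 h2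
    tauto

lemma Separated.eq_of_div_eq {S : Set ℕ} {M : ℕ} (hS : Separated S M) (hM : 0 < M) {k l : ℕ}
    (hk : k ∈ S) (hl : l ∈ S) (h : k / M = l / M) : k = l := by
  have e1 := Nat.div_add_mod k M
  have e2 := Nat.div_add_mod l M
  have m1 := Nat.mod_lt k hM
  have m2 := Nat.mod_lt l hM
  rw [h] at e1
  rcases lt_trichotomy k l with hkl | hkl | hkl
  · have := hS k hk l hl hkl
    omega
  · exact hkl
  · have := hS l hl k hk hkl
    omega

lemma Separated.ncard_le {S : Set ℕ} {M n : ℕ} (hS : Separated S M) (hM : 0 < M)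
    (hn : ∀ k ∈ S, k ≤ n) : S.ncard ≤ n / M + 1 := by
  have h : S.ncard ≤ (Finset.range (n / M + 1) : Set ℕ).ncard :=
    Set.ncard_le_ncard_of_injOn (· / M)
      (fun k hk => by
        simpa using Nat.lt_succ_of_le (Nat.div_le_div_right (hn k hk)))
      (fun k hk l hl h => hS.eq_of_div_eq hM hk hl h) (Finset.finite_toSet _)
  rwa [Set.ncard_coe_finset, Finset.card_range] at h

/-- Position of the first element of `S` in the `i`-th block of length `M` (or `M` if there is
none). -/
noncomputable def blockCode (S : Set ℕ) (M i : ℕ) : ℕ :=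
  sInf ({r | r < M ∧ M * i + r ∈ S} ∪ {M})

lemma blockCode_le (S : Set ℕ) (M i : ℕ) : blockCode S M i ≤ M := Nat.sInf_le (Or.inr rfl)

lemma Separated.mem_iff_blockCode {S : Set ℕ} {M : ℕ} (hS : Separated S M) (hM : 0 < M) (k : ℕ) :
    k ∈ S ↔ blockCode S M (k / M) = k % M := by
  have e1 := Nat.div_add_mod k M
  have m1 := Nat.mod_lt k hM
  have hmem : blockCode S M (k / M) ∈ ({r | r < M ∧ M * (k / M) + r ∈ S} ∪ {M} : Set ℕ) :=
    Nat.sInf_mem ⟨M, Or.inr rfl⟩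
  constructor
  · intro hk
    have hle : blockCode S M (k / M) ≤ k % M :=
      Nat.sInf_le (Or.inl ⟨m1, by rwa [e1]⟩)
    rcases hmem with ⟨h1, h2⟩ | h
    · have := hS.eq_of_div_eq hM h2 hk (by
        rw [Nat.mul_add_div hM, Nat.div_eq_of_lt h1, add_zero])
      omega
    · simp only [Set.mem_singleton_iff] at h
      omega
  · intro h
    rcases hmem with ⟨h1, h2⟩ | h'
    · rwa [h, e1] at h2
    · simp only [Set.mem_singleton_iff] at h'
      omega

lemma Separated.eq_of_blockCode_eq {S S' : Set ℕ} {M n : ℕ} (hS : Separated S M)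
    (hS' : Separated S' M) (hM : 0 < M) (hn : ∀ k ∈ S, k ≤ n) (hn' : ∀ k ∈ S', k ≤ n)
    (h : ∀ i ≤ n / M, blockCode S M i = blockCode S' M i) : S = S' := by
  ext k
  by_cases hk : k ≤ n
  · rw [hS.mem_iff_blockCode hM, hS'.mem_iff_blockCode hM, h _ (Nat.div_le_div_right hk)]
  · exact ⟨fun h => absurd (hn k h) hk, fun h => absurd (hn' k h) hk⟩

/-- Encoding of the endpoints of the components of `hull s n M`. -/
noncomputable def hullCode (n M : ℕ) (s : Finset ℕ) (i : Fin (n / M + 1)) :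
    Fin (M + 1) × Fin (M + 1) :=
  (⟨blockCode (leftBd (hull s n M)) M i, Nat.lt_succ_of_le (blockCode_le _ _ _)⟩,
    ⟨blockCode (rightBd (hull s n M)) M i, Nat.lt_succ_of_le (blockCode_le _ _ _)⟩)

lemma le_of_mem_hull {s : Finset ℕ} {n M k : ℕ} (h : k ∈ (hull s n M : Set ℕ)) : k ≤ n :=
  (Finset.mem_Icc.1 (hull_subset_Icc _ _ _ h)).2

lemma hull_eq_of_hullCode_eq {s s' : Finset ℕ} {n M : ℕ} (hM : 0 < M)
    (hs : s ⊆ Finset.Icc 1 n) (hs' : s' ⊆ Finset.Icc 1 n)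
    (h : hullCode n M s = hullCode n M s') : hull s n M = hull s' n M := by
  have hcode := fun i : ℕ => fun hi : i ≤ n / M => congrFun h ⟨i, Nat.lt_succ_of_le hi⟩
  simp only [hullCode, Prod.mk.injEq, Fin.mk.injEq] at hcode
  have hzero : ∀ t : Finset ℕ, 0 ∉ (hull t n M : Set ℕ) := fun t h0 => by
    simpa using hull_subset_Icc _ _ _ h0
  refine Finset.coe_injective (eq_of_endpoints_eq (hzero s) (hzero s') ?_ ?_)
  · refine Separated.eq_of_blockCode_eq (n := n) (M := M) ?_ ?_ hM
      (fun k hk => le_of_mem_hull hk.1) (fun k hk => le_of_mem_hull hk.1)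
      (fun i hi => (hcode i hi).1)
    · rw [coe_hull hs]; exact separated_leftBd_thick _ _
    · rw [coe_hull hs']; exact separated_leftBd_thick _ _
  · refine Separated.eq_of_blockCode_eq (n := n) (M := M) ?_ ?_ hM
      (fun k hk => le_of_mem_hull hk.1) (fun k hk => le_of_mem_hull hk.1)
      (fun i hi => (hcode i hi).2)
    · rw [coe_hull hs]; exact separated_rightBd_thick _ _
    · rw [coe_hull hs']; exact separated_rightBd_thick _ _

lemma ncard_natBd_hull_le {s : Finset ℕ} {n M : ℕ} (hM : 0 < M) (hs : s ⊆ Finset.Icc 1 n) :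
    (natBd (hull s n M : Set ℕ)).ncard ≤ 2 * (n / M + 1) := by
  rw [natBd_eq_union]
  refine (Set.ncard_union_le _ _).trans ?_
  have h1 : (leftBd (hull s n M : Set ℕ)).ncard ≤ n / M + 1 :=
    Separated.ncard_le (by rw [coe_hull hs]; exact separated_leftBd_thick _ _) hM
      (fun k hk => le_of_mem_hull hk.1)
  have h2 : (rightBd (hull s n M : Set ℕ)).ncard ≤ n / M + 1 :=
    Separated.ncard_le (by rw [coe_hull hs]; exact separated_rightBd_thick _ _) hM
      (fun k hk => le_of_mem_hull hk.1)
  omega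

section Measure

variable {X : Type*} [MeasurableSpace X]

lemma measurableSet_setOf_cut {E : X → Set ℕ} (hE : ∀ n : ℕ, MeasurableSet {x | n ∈ E x})
    (n : ℕ) (P : Finset ℕ → Prop) : MeasurableSet {x | P (cut (E x) n)} := by
  have hfib : ∀ s : Finset ℕ, MeasurableSet {x | cut (E x) n = s} := by
    intro s
    have : {x | cut (E x) n = s} = ⋂ k : ℕ, {x | ((1 ≤ k ∧ k ≤ n) ∧ k ∈ E x) ↔ k ∈ s} := by
      ext x
      simp [Finset.ext_iff, mem_cut]
    rw [this]
    exact MeasurableSet.iInter fun k =>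
      MeasurableSet.iff ((MeasurableSet.const _).inter (hE k)) (MeasurableSet.const _)
  have : {x | P (cut (E x) n)} = ⋃ s ∈ {s | P s}, {x | cut (E x) n = s} := by
    ext x
    simp
  rw [this]
  exact MeasurableSet.biUnion (Set.to_countable _) fun s _ => hfib s

lemma exists_large_fiber (μ : Measure X) {κ : Type*} [Fintype κ] (g : X → κ) {B : Set X}
    (hB : 0 < μ B) :
    ∃ y ∈ B, μ B ≤ Fintype.card κ * μ (B ∩ {x | g x = g y}) := by
  classical
  by_contra! hlt
  obtain ⟨y₀, -⟩ := nonempty_of_measure_ne_zero hB.ne'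
  obtain ⟨c, -, hc⟩ := Finset.exists_max_image Finset.univ (fun c => μ (B ∩ {x | g x = c}))
    ⟨g y₀, Finset.mem_univ _⟩
  have hsum : μ B ≤ Fintype.card κ * μ (B ∩ {x | g x = c}) := by
    calc μ B ≤ μ (⋃ c ∈ (Finset.univ : Finset κ), B ∩ {x | g x = c}) :=
          measure_mono fun x hx => by simpa using hx
      _ ≤ ∑ c, μ (B ∩ {x | g x = c}) := measure_biUnion_finset_le _ _
      _ ≤ ∑ _d : κ, μ (B ∩ {x | g x = c}) := Finset.sum_le_sum fun d hd => hc d hd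
      _ = _ := by simp
  have hpos : μ (B ∩ {x | g x = c}) ≠ 0 := fun h0 => by
    rw [h0, mul_zero] at hsum
    exact hB.not_ge hsum
  obtain ⟨y, hyB, rfl⟩ := nonempty_of_measure_ne_zero hpos
  exact (hlt y hyB).not_ge hsum

lemma frequently_card_cut {S : Set ℕ} {β : ℝ} (h : β < upperDensity S) :
    ∃ᶠ n in atTop, β * n ≤ (cut S n).card := by
  have hf : ∃ᶠ n in atTop, β < dens S n := by
    refine frequently_lt_of_lt_limsup ?_ h
    refine IsBoundedUnder.isCoboundedUnder_le ⟨0, ?_⟩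
    refine eventually_map.2 (Eventually.of_forall fun n => ?_)
    unfold dens
    positivity
  refine (hf.and_eventually (eventually_gt_atTop 0)).mono fun n hn => ?_
  obtain ⟨h1, h2⟩ := hn
  rw [dens, ← coe_cut, Set.ncard_coe_finset, lt_div_iff₀ (by exact_mod_cast h2)] at h1
  exact h1.le

lemma frequently_measure_ge (μ : Measure X) {β : ℝ} {E : X → Set ℕ} {A : Set X}
    (hApos : 0 < μ A) (hdens : ∀ x ∈ A, β < upperDensity (E x)) :
    ∃ᶠ n : ℕ in atTop, ENNReal.ofReal (1 / (n : ℝ) ^ 2) ≤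
      μ (A ∩ {x | β * n ≤ (cut (E x) n).card}) := by
  intro hlt
  simp only [not_le] at hlt
  obtain ⟨N, hN⟩ := eventually_atTop.1 hlt
  have hsum : ∑' n : ℕ, μ (A ∩ {x | β * (n + N : ℕ) ≤ (cut (E x) (n + N)).card}) ≠ ⊤ := by
    have hs : Summable fun n : ℕ => 1 / ((n + N : ℕ) : ℝ) ^ 2 :=
      (summable_nat_add_iff N).2 (Real.summable_one_div_nat_pow.2 (by norm_num))
    refine ne_top_of_le_ne_top hs.tsum_ofReal_ne_top (ENNReal.tsum_le_tsum fun n => ?_)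
    exact (hN (n + N) (by omega)).le
  have hzero := measure_setOfPred_frequently_eq_zero hsum
  refine hApos.not_ge (hzero ▸ measure_mono fun x hx => ?_)
  have hfr := frequently_card_cut (hdens x hx)
  rw [← map_add_atTop_eq_nat N, frequently_map] at hfr
  exact hfr.mono fun n hn => ⟨hx, hn⟩

end Measure

lemma log_count_div_le {n k m : ℕ} (hm : 0 < m) (hmn : m ≤ n) :
    Real.log (((n + 1) ^ (k + 2) * ((m + 1) * (m + 1)) ^ (n / m + 1) : ℕ) : ℝ) / n ≤
      (k + 2) * Real.log (n + 1) / n + 4 * Real.log (m + 1) / m := by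
  have hm' : (0 : ℝ) < m := by exact_mod_cast hm
  have hmn' : (m : ℝ) ≤ n := by exact_mod_cast hmn
  have hn' : (0 : ℝ) < n := hm'.trans_le hmn'
  have hL : 0 ≤ Real.log (m + 1) := Real.log_nonneg (by linarith)
  have hdiv : ((n / m : ℕ) : ℝ) ≤ n / m := Nat.cast_div_le
  have hone : (1 : ℝ) ≤ n / m := by rwa [le_div_iff₀ hm', one_mul]
  push_cast
  rw [Real.log_mul (by positivity) (by positivity), Real.log_pow, Real.log_pow,
    Real.log_mul (by positivity) (by positivity), add_div]
  push_cast
  have key : (((n / m : ℕ) : ℝ) + 1) * (Real.log (m + 1) + Real.log (m + 1)) ≤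
      4 * Real.log (m + 1) / m * n := by
    calc _ ≤ (2 * ((n : ℝ) / m)) * (2 * Real.log (m + 1)) := by
          rw [← two_mul (Real.log _)]
          gcongr
          linarith
      _ = _ := by ring
  refine add_le_add le_rfl ?_
  rwa [div_le_iff₀ hn']

lemma ofReal_exp_le_of_le_mul {n K : ℕ} (hn : 0 < n) (hK : 0 < K) {a : ENNReal}
    (h : ENNReal.ofReal (1 / (n : ℝ) ^ 2) ≤ K * a) :
    ENNReal.ofReal (Real.exp (-(n : ℝ) * (Real.log K / n)) / (n : ℝ) ^ 2) ≤ a := by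
  have hn' : (0 : ℝ) < n := by exact_mod_cast hn
  have hK' : (0 : ℝ) < K := by exact_mod_cast hK
  have hexp : Real.exp (-(n : ℝ) * (Real.log K / n)) = (K : ℝ)⁻¹ := by
    rw [neg_mul, mul_div_cancel₀ _ hn'.ne', Real.exp_neg, Real.exp_log hK']
  have hmul : ENNReal.ofReal (1 / (n : ℝ) ^ 2) =
      K * ENNReal.ofReal ((K : ℝ)⁻¹ / (n : ℝ) ^ 2) := by
    rw [← ENNReal.ofReal_natCast, ← ENNReal.ofReal_mul hK'.le]
    congr 1
    field_simp
  rw [hexp]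
  rw [hmul] at h
  exact (ENNReal.mul_le_mul_iff_right (by exact_mod_cast hK.ne') (ENNReal.natCast_ne_top _)).1 h

lemma eventually_mul_log_div_le (a : ℝ) {ε : ℝ} (hε : 0 < ε) :
    ∀ᶠ n : ℕ in atTop, a * Real.log (n + 1) / n ≤ ε := by
  have h1 : Tendsto (fun x : ℝ => Real.log (x + 1) / x) atTop (nhds 0) := by
    have hlog : Tendsto (fun x : ℝ => Real.log x / (1 * x + (-1))) atTop (nhds 0) := by
      simpa using Real.tendsto_pow_log_div_mul_add_atTop 1 (-1) 1 one_ne_zero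
    refine (hlog.comp (tendsto_atTop_add_const_right atTop (1 : ℝ) tendsto_id)).congr fun x => ?_
    simp
  have h2 := (h1.comp tendsto_natCast_atTop_atTop).const_mul a
  rw [mul_zero] at h2
  filter_upwards [h2.eventually (eventually_le_nhds hε)] with n hn
  simpa [mul_div_assoc] using hn

lemma tendsto_four_mul_log_div :
    Tendsto (fun j : ℕ => 4 * Real.log (((j + 1 : ℕ) : ℝ) + 1) / ((j + 1 : ℕ) : ℝ)) atTop
      (nhds 0) := by
  refine (tendsto_add_atTop_iff_nat
    (f := fun n : ℕ => 4 * Real.log ((n : ℝ) + 1) / (n : ℝ)) 1).2 ?_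
  refine tendsto_order.2 ⟨fun a ha => Eventually.of_forall fun n => ha.trans_le ?_, fun a ha => ?_⟩
  · have : 0 ≤ Real.log ((n : ℝ) + 1) := Real.log_nonneg (by linarith [n.cast_nonneg (α := ℝ)])
    positivity
  · exact (eventually_mul_log_div_le 4 (half_pos ha)).mono fun n hn => by linarith

section Measure

variable {X : Type*} [MeasurableSpace X]

/-- At infinitely many times, on a set of measure at least `1 / (n ^ 2 (n + 1) ^ (k + 2))`, the
traces have density at least `β` and their thickenings have prescribed cardinality. -/
lemma exists_times (μ : Measure X) {β : ℝ} {E : X → Set ℕ}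
    (hE : ∀ n : ℕ, MeasurableSet {x | n ∈ E x}) {A : Set X} (hA : MeasurableSet A)
    (hApos : 0 < μ A) (hdens : ∀ x ∈ A, β < upperDensity (E x)) :
    ∃ (ν : ℕ → ℕ) (C : ℕ → Set X) (c : ℕ → ℕ → ℕ), StrictMono ν ∧
      (∀ k, k + 1 ≤ ν k) ∧
      (∀ k, (k + 2) * Real.log (ν k + 1) / ν k ≤ 1 / ((k : ℝ) + 1)) ∧
      (∀ k, MeasurableSet (C k) ∧ C k ⊆ A) ∧
      (∀ k, ENNReal.ofReal (1 / (ν k : ℝ) ^ 2) ≤ ((ν k + 1) ^ (k + 2) : ℕ) * μ (C k)) ∧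
      (∀ k, ∀ x ∈ C k, β * ν k ≤ (cut (E x) (ν k)).card) ∧
      (∀ k, ∀ x ∈ C k, ∀ M ≤ k + 1, (hull (cut (E x) (ν k)) (ν k) M).card = c k M) ∧
      (∀ k M, c k M ≤ ν k) ∧ (∀ k, Monotone (c k)) := by
  have hfreq := fun k : ℕ => (frequently_measure_ge μ hApos hdens).and_eventually
    ((eventually_ge_atTop (k + 1)).and
      (eventually_mul_log_div_le ((k : ℝ) + 2) (ε := 1 / ((k : ℝ) + 1)) (by positivity)))
  obtain ⟨ν, hν, hprop⟩ := extraction_forall_of_frequently hfreq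
  let B : ℕ → Set X := fun k => A ∩ {x | β * ν k ≤ (cut (E x) (ν k)).card}
  let g : ∀ k : ℕ, Finset ℕ → Fin (k + 2) → Fin (ν k + 1) := fun k s M =>
    ⟨(hull s (ν k) M).card,
      Nat.lt_succ_of_le (card_le_of_subset_Icc (hull_subset_Icc _ _ _))⟩
  have hBpos : ∀ k, 0 < μ (B k) := fun k => by
    refine lt_of_lt_of_le ?_ (hprop k).1
    have : (0 : ℝ) < ν k := by exact_mod_cast lt_of_lt_of_le k.succ_pos (hprop k).2.1
    exact ENNReal.ofReal_pos.2 (by positivity)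
  choose y hyB hy using fun k => exists_large_fiber μ (fun x => g k (cut (E x) (ν k))) (hBpos k)
  refine ⟨ν, fun k => B k ∩ {x | g k (cut (E x) (ν k)) = g k (cut (E (y k)) (ν k))},
    fun k M => (hull (cut (E (y k)) (ν k)) (ν k) M).card, hν, fun k => (hprop k).2.1,
    fun k => (hprop k).2.2, fun k => ⟨?_, fun x hx => hx.1.1⟩, fun k => ?_, fun k x hx => hx.1.2,
    fun k x hx M hM => ?_, fun k M => card_le_of_subset_Icc (hull_subset_Icc _ _ _),
    fun k M M' h => Finset.card_le_card (hull_mono _ _ h)⟩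
  · exact (hA.inter (measurableSet_setOf_cut hE (ν k) fun s => β * ν k ≤ s.card)).inter
      (measurableSet_setOf_cut hE (ν k) fun s => g k s = g k (cut (E (y k)) (ν k)))
  · refine (hprop k).1.trans ((hy k).trans_eq ?_)
    simp
  · exact congrArg Fin.val (congrFun hx.2 ⟨M, Nat.lt_succ_of_le hM⟩)

/-- On a large subset of `C` the thickening of the trace of `E x` is constant. -/
lemma exists_constant_hull (μ : Measure X) {E : X → Set ℕ}
    (hE : ∀ n : ℕ, MeasurableSet {x | n ∈ E x}) {C : Set X} (hC : MeasurableSet C)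
    (hCpos : 0 < μ C) (n : ℕ) {m : ℕ} (hm : 0 < m) :
    ∃ D ⊆ C, MeasurableSet D ∧ μ C ≤ (((m + 1) * (m + 1)) ^ (n / m + 1) : ℕ) * μ D ∧
      ∃ y ∈ C, ∀ x ∈ D, hull (cut (E x) n) n m = hull (cut (E y) n) n m := by
  obtain ⟨y, hyC, hy⟩ := exists_large_fiber μ (fun x => hullCode n m (cut (E x) n)) hCpos
  refine ⟨_, Set.inter_subset_left, hC.inter (measurableSet_setOf_cut hE n fun s =>
    hullCode n m s = hullCode n m (cut (E y) n)), hy.trans_eq (by simp), y, hyC, fun x hx => ?_⟩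
  exact hull_eq_of_hullCode_eq hm (cut_subset_Icc _ _) (cut_subset_Icc _ _) hx.2

end Measure

/-- A sequence of bounded monotone functions has a subsequence converging at every point, and
uniformly on initial segments of growing length. -/
lemma exists_subseq_close {v : ℕ → ℕ → ℝ} (h0 : ∀ k M, 0 ≤ v k M) (h1 : ∀ k M, v k M ≤ 1)
    (hv : ∀ k, Monotone (v k)) :
    ∃ (w : ℕ → ℝ) (φ : ℕ → ℕ), StrictMono φ ∧ Monotone w ∧ (∀ M, w M ≤ 1) ∧
      ∀ j, ∀ M ≤ j + 1, |v (φ j) M - w M| ≤ 1 / ((j : ℝ) + 1) := by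
  have hcpt : IsCompact (Set.univ.pi fun _ : ℕ => Set.Icc (0 : ℝ) 1) :=
    isCompact_univ_pi fun _ => isCompact_Icc
  obtain ⟨w, hw, φ, hφ, hlim⟩ := hcpt.tendsto_subseq (x := v)
    fun k => fun M _ => ⟨h0 k M, h1 k M⟩
  rw [tendsto_pi_nhds] at hlim
  have hev : ∀ j : ℕ, ∀ᶠ i in atTop, ∀ M ≤ j + 1, |v (φ i) M - w M| ≤ 1 / ((j : ℝ) + 1) := by
    intro j
    refine (Set.finite_Iic (j + 1)).eventually_all.2 fun M _ => ?_
    have := (tendsto_iff_norm_sub_tendsto_zero.1 (hlim M)).eventually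
      (eventually_le_nhds (show (0 : ℝ) < 1 / ((j : ℝ) + 1) by positivity))
    simpa using this
  obtain ⟨ψ, hψ, hclose⟩ := extraction_forall_of_eventually hev
  refine ⟨w, φ ∘ ψ, hφ.comp hψ, fun M M' h => ?_, fun M => (hw M trivial).2, hclose⟩
  exact le_of_tendsto_of_tendsto' (hlim M) (hlim M') fun i => hv _ h

lemma div_natCast_le_one {a n : ℕ} (h : a ≤ n) : (a : ℝ) / n ≤ 1 :=
  div_le_one_of_le₀ (by exact_mod_cast h) n.cast_nonneg

/-- Borel–Cantelli argument: from a measurable family `E : X → P(ℕ)` of sets of integers with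
`d̄(E(x)) > β` on a set `A` of positive measure, one extracts a subsequence `𝔫`, measurable
sets `Aₙ ⊆ A` of not exponentially small measure, and a Følner sequence `Fₙ ⊆ ⟦1,n⟧` with
`∂Fₙ ⊆ E(x)` for `x ∈ Aₙ`, along which `E` is uniformly dense and
`d_n(E(x) ∩ Fₙ)` is asymptotically at least `β` uniformly on `Aₙ`. -/
theorem stmt1 {X : Type*} [MeasurableSpace X] (lam : Measure X) [IsFiniteMeasure lam]
    (β : ℝ) (hβ : 0 < β)
    (E : X → Set ℕ) (hEmeas : ∀ n : ℕ, MeasurableSet {x | n ∈ E x})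
    (A : Set X) (hA : MeasurableSet A) (hApos : 0 < lam A)
    (hdens : ∀ x ∈ A, β < upperDensity (E x)) :
    ∃ (𝔫 : ℕ → ℕ) (As : ℕ → Set X) (F : ℕ → Finset ℕ) (δ : ℕ → ℝ),
      StrictMono 𝔫 ∧
      (∀ k, MeasurableSet (As k) ∧ As k ⊆ A) ∧
      (∀ k, F k ⊆ Finset.Icc 1 (𝔫 k)) ∧
      (∀ k, ∀ x ∈ As k, natBd (F k : Set ℕ) ⊆ E x) ∧
      (β ≤ liminf (fun k => ((F k).card : ℝ) / (𝔫 k : ℝ)) atTop) ∧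
      Tendsto δ atTop (nhds 0) ∧
      (∀ k, ENNReal.ofReal (Real.exp (-(𝔫 k : ℝ) * δ k) / (𝔫 k : ℝ) ^ 2) ≤ lam (As k)) ∧
      limsup (fun k => ((natBd (F k : Set ℕ)).ncard : ℝ) / (𝔫 k : ℝ)) atTop = 0 ∧
      Tendsto (fun M : ℕ => limsup (fun k =>
          sSup {r : ℝ | ∃ x ∈ As k,
            r = (((F k : Set ℕ) \ thick (E x) M).ncard : ℝ) / (𝔫 k : ℝ)}) atTop)
        atTop (nhds 0) ∧
      β ≤ liminf (fun k =>
          sInf {r : ℝ | ∃ x ∈ As k,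
            r = ((E x ∩ (F k : Set ℕ)).ncard : ℝ) / (𝔫 k : ℝ)}) atTop := by
  obtain ⟨ν, C, c, hν, hνk, hνlog, hC, hCμ, hCβ, hCc, hcν, hcmono⟩ :=
    exists_times lam hEmeas hA hApos hdens
  obtain ⟨w, φ, hφ, hwmono, hw1, hclose⟩ := exists_subseq_close
    (v := fun k M => (c k M : ℝ) / ν k) (fun k M => by positivity)
    (fun k M => div_natCast_le_one (hcν k M))
    (fun k M M' h => by
      have := hcmono k h
      dsimp only
      gcongr)
  have hνpos : ∀ k, 0 < ν k := fun k => k.succ_pos.trans_le (hνk k)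
  have hCpos : ∀ k, 0 < lam (C k) := fun k => by
    refine pos_iff_ne_zero.2 fun h0 => ?_
    have h := hCμ k
    rw [h0, mul_zero] at h
    have hpos : (0 : ℝ) < ν k := by exact_mod_cast hνpos k
    exact (ENNReal.ofReal_pos.2 (by positivity : (0 : ℝ) < 1 / (ν k : ℝ) ^ 2)).not_ge h
  choose D hDC hDmeas hDμ y hyC hyD using fun j => exists_constant_hull lam hEmeas (hC (φ j)).1
    (hCpos (φ j)) (ν (φ j)) j.succ_pos
  set n : ℕ → ℕ := fun j => ν (φ j)
  set F : ℕ → Finset ℕ := fun j => hull (cut (E (y j)) (n j)) (n j) (j + 1)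
  have hnj : ∀ j, j + 1 ≤ n j := fun j =>
    (Nat.succ_le_succ (hφ.id_le j)).trans (hνk (φ j))
  have hnpos : ∀ j, (0 : ℝ) < n j := fun j => by exact_mod_cast hνpos (φ j)
  have hDpos : ∀ j, (D j).Nonempty := fun j => by
    refine nonempty_of_measure_ne_zero (μ := lam) fun h0 => ?_
    have h := hDμ j
    rw [h0, mul_zero] at h
    exact (hCpos (φ j)).not_ge h
  have hFx : ∀ j, ∀ x ∈ D j, hull (cut (E x) (n j)) (n j) (j + 1) = F j := hyD
  have hFIcc : ∀ j, F j ⊆ Finset.Icc 1 (n j) := fun j => hull_subset_Icc _ _ _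
  have hlow : ∀ j, ∀ x ∈ D j, β ≤ ((E x ∩ (F j : Set ℕ)).ncard : ℝ) / n j := by
    intro j x hx
    rw [le_div_iff₀ (hnpos j)]
    refine (hCβ _ x (hDC j hx)).trans ?_
    rw [← Set.ncard_coe_finset]
    refine Nat.cast_le.2 (Set.ncard_le_ncard (fun k hk => ?_) ((F j).finite_toSet.inter_of_right _))
    refine ⟨(mem_cut.1 hk).2, ?_⟩
    rw [← hFx j x hx]
    exact subset_hull (cut_subset_Icc _ _) _ hk
  have hinter : ∀ j x, ((E x ∩ (F j : Set ℕ)).ncard : ℝ) / n j ≤ (F j).card / n j := by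
    intro j x
    gcongr
    rw [← Set.ncard_coe_finset]
    exact Set.ncard_le_ncard Set.inter_subset_right (F j).finite_toSet
  have hFone : ∀ j, ((F j).card : ℝ) / n j ≤ 1 := fun j =>
    div_natCast_le_one (card_le_of_subset_Icc (hFIcc j))
  have hdiff : ∀ j, ∀ x ∈ D j, ∀ M ≤ j + 1,
      (((F j : Set ℕ) \ thick (E x) M).ncard : ℝ) / n j ≤
        (⨆ i, w i) - w M + 2 * (1 / ((j : ℝ) + 1)) := by
    intro j x hx M hM
    have hsub : hull (cut (E x) (n j)) (n j) M ⊆ F j := hFx j x hx ▸ hull_mono _ _ hM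
    have hcard : ((F j : Set ℕ) \ thick (E x) M).ncard ≤ c (φ j) (j + 1) - c (φ j) M := by
      have hjφ : j ≤ φ j := hφ.id_le j
      rw [← hCc _ x (hDC j hx) (j + 1) (by omega), ← hCc _ x (hDC j hx) M (by omega)]
      rw [show hull (cut (E x) (ν (φ j))) (ν (φ j)) (j + 1) = F j from hFx j x hx,
        ← Finset.card_sdiff_of_subset hsub, ← Set.ncard_coe_finset]
      refine Set.ncard_le_ncard (fun k hk => ?_) (Finset.finite_toSet _)
      rw [Finset.coe_sdiff]
      refine ⟨hk.1, fun hk' => hk.2 ?_⟩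
      rw [coe_hull (cut_subset_Icc _ _), coe_cut] at hk'
      exact thick_mono Set.inter_subset_left le_rfl hk'
    have hcard' : (((F j : Set ℕ) \ thick (E x) M).ncard : ℝ) ≤
        c (φ j) (j + 1) - c (φ j) M := by
      rw [← Nat.cast_sub (hcmono _ hM)]
      exact_mod_cast hcard
    have h1 := (abs_le.1 (hclose j (j + 1) le_rfl)).2
    have h2 := (abs_le.1 (hclose j M hM)).1
    have h3 : w (j + 1) ≤ ⨆ i, w i := le_ciSup ⟨1, Set.forall_mem_range.2 hw1⟩ (j + 1)
    calc _ ≤ ((c (φ j) (j + 1) : ℝ) - c (φ j) M) / n j := by gcongr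
      _ = (c (φ j) (j + 1) : ℝ) / ν (φ j) - c (φ j) M / ν (φ j) := sub_div _ _ _
      _ ≤ _ := by linarith
  have hlim : Tendsto (fun j : ℕ => 1 / ((j : ℝ) + 1)) atTop (nhds 0) :=
    tendsto_one_div_add_atTop_nhds_zero_nat
  refine ⟨n, D, F, fun j => Real.log (((n j + 1) ^ (φ j + 2) *
      ((j + 1 + 1) * (j + 1 + 1)) ^ (n j / (j + 1) + 1) : ℕ) : ℝ) / n j,
    hν.comp hφ, fun j => ⟨hDmeas j, (hDC j).trans (hC _).2⟩, hFIcc, fun j x hx => ?_, ?_, ?_,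
    fun j => ?_, ?_, ?_, ?_⟩
  · rw [← hFx j x hx, coe_hull (cut_subset_Icc _ _), coe_cut]
    exact (natBd_thick_subset _ _).trans Set.inter_subset_left
  · refine le_liminf_of_le ?_ (Eventually.of_forall fun j => ?_)
    · exact (isBoundedUnder_of ⟨1, hFone⟩ : IsBoundedUnder (· ≤ ·) atTop _).isCoboundedUnder_ge
    · obtain ⟨x, hx⟩ := hDpos j
      exact (hlow j x hx).trans (hinter j x)
  · have hbound := hlim.add tendsto_four_mul_log_div
    rw [add_zero] at hbound
    refine squeeze_zero (fun j => ?_) (fun j => ?_) hbound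
    · exact div_nonneg (Real.log_natCast_nonneg _) (hnpos j).le
    · refine (log_count_div_le j.succ_pos (hnj j)).trans (add_le_add ?_ le_rfl)
      refine (hνlog (φ j)).trans ?_
      have : (j : ℝ) ≤ φ j := by exact_mod_cast hφ.id_le j
      gcongr
  · refine ofReal_exp_le_of_le_mul (hνpos (φ j)) (by positivity) ((hCμ (φ j)).trans ?_)
    rw [Nat.cast_mul, mul_assoc]
    gcongr
    exact hDμ j
  · refine Tendsto.limsup_eq (squeeze_zero (fun j => by positivity) (fun j => ?_)
      (by simpa using hlim.const_mul 4))
    have hb : ((natBd (F j : Set ℕ)).ncard : ℝ) ≤ 2 * ((n j / (j + 1) : ℕ) + 1) := by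
      exact_mod_cast ncard_natBd_hull_le j.succ_pos (cut_subset_Icc _ _)
    have hd : ((n j / (j + 1) : ℕ) : ℝ) ≤ n j / ((j : ℝ) + 1) := by
      exact_mod_cast (Nat.cast_div_le (α := ℝ) (m := n j) (n := j + 1))
    have hone : (1 : ℝ) ≤ n j / ((j : ℝ) + 1) := by
      rw [le_div_iff₀ (by positivity), one_mul]
      exact_mod_cast hnj j
    rw [div_le_iff₀ (hnpos j)]
    calc _ ≤ 4 * (n j / ((j : ℝ) + 1)) := by linarith
      _ = _ := by ring
  · have hsup : Tendsto w atTop (nhds (⨆ i, w i)) :=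
      tendsto_atTop_ciSup hwmono ⟨1, Set.forall_mem_range.2 hw1⟩
    have hsub : Tendsto (fun M => (⨆ i, w i) - w M) atTop (nhds 0) := by
      simpa using hsup.const_sub (⨆ i, w i)
    have hnn : ∀ M j, 0 ≤ sSup {r : ℝ | ∃ x ∈ D j,
        r = (((F j : Set ℕ) \ thick (E x) M).ncard : ℝ) / (n j : ℝ)} := by
      refine fun M j => Real.sSup_nonneg ?_
      rintro r ⟨x, -, rfl⟩
      positivity
    have hle : ∀ M, ∀ᶠ j in atTop, sSup {r : ℝ | ∃ x ∈ D j,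
        r = (((F j : Set ℕ) \ thick (E x) M).ncard : ℝ) / (n j : ℝ)} ≤
          (⨆ i, w i) - w M + 2 * (1 / ((j : ℝ) + 1)) := by
      intro M
      filter_upwards [eventually_ge_atTop M] with j hj
      obtain ⟨x, hx⟩ := hDpos j
      refine csSup_le ⟨_, x, hx, rfl⟩ ?_
      rintro r ⟨z, hz, rfl⟩
      exact hdiff j z hz M (by omega)
    have hbd : ∀ M, Tendsto (fun j : ℕ => (⨆ i, w i) - w M + 2 * (1 / ((j : ℝ) + 1))) atTop
        (nhds ((⨆ i, w i) - w M)) := fun M => by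
      simpa using (hlim.const_mul 2).const_add ((⨆ i, w i) - w M)
    refine squeeze_zero (fun M => ?_) (fun M => ?_) hsub
    · refine le_limsup_of_le ((hbd M).isBoundedUnder_le.mono_le (hle M)) fun b hb => ?_
      obtain ⟨j, hj⟩ := hb.exists
      exact (hnn M j).trans hj
    · rw [← (hbd M).limsup_eq]
      exact limsup_le_limsup (hle M)
        (isBoundedUnder_of ⟨0, hnn M⟩ : IsBoundedUnder (· ≥ ·) atTop _).isCoboundedUnder_le
        (hbd M).isBoundedUnder_le
  · refine le_liminf_of_le ?_ (Eventually.of_forall fun j => ?_)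
    · refine IsBoundedUnder.isCoboundedUnder_ge (isBoundedUnder_of ⟨1, fun j => ?_⟩)
      obtain ⟨x, hx⟩ := hDpos j
      refine csInf_le_of_le ⟨0, ?_⟩ ⟨x, hx, rfl⟩ ((hinter j x).trans (hFone j))
      rintro r ⟨z, -, rfl⟩
      positivity
    · obtain ⟨x, hx⟩ := hDpos j
      refine le_csInf ⟨_, x, hx, rfl⟩ ?_
      rintro r ⟨z, hz, rfl⟩
      exact hlow j z hz
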